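/- For every δ > 0 and every n ≥ 144/δ²: if A_1,…,A_n are equivalence relations on a finite set X with |ker(A_i)| ≥ (3 + δ)n for each i ∈ [n], then there exist 2n distinct elements x_1, y_1, …, x_n, y_n ∈ X with x_i ∼_{A_i} y_i for each i ∈ [n]. -/

import Mathlib

namespace RainbowMatching

/-- `p` assigns to each colour in `D` an edge of that colour, and these edges are disjoint. -/
structure IsRainbow {C X : Type*} (A : C → Setoid X) (D : Finset C) (p : C → Bool → X) :
    Prop where
  rel : ∀ d ∈ D, (A d).r (p d true) (p d false)
  inj : ∀ c ∈ D, ∀ d ∈ D, ∀ s t, p c s = p d t → c = d ∧ s = t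

/-- A potential switch: the colour `src` is to be placed on an edge joining an endpoint of the
matching edge of colour `dst` to one of the two vertices `lab`. -/
structure Step (C X : Type*) where
  src : C
  dst : C
  lab : Bool → X

/-- The vertices of the two edges offered by a step are matched, respectively unmatched, and the
edges have the right colour. -/
structure IsStep {C X : Type*} (A : C → Setoid X) (D : Finset C) (p : C → Bool → X)
    (e : Step C X) : Prop where
  dst_mem : e.dst ∈ D
  free : ∀ t, ∀ d ∈ D, ∀ s, e.lab t ≠ p d s
  rel : ∀ t, (A e.src).r (p e.dst t) (e.lab t)
  lab_ne : e.lab true ≠ e.lab false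

/-- Two steps switch different matching edges and use different unmatched vertices. -/
def Indep {C X : Type*} (e e' : Step C X) : Prop :=
  e.dst ≠ e'.dst ∧ ∀ s t, e.lab s ≠ e'.lab t

/-- The last colour of a path of steps starting at a given colour. -/
def endpt {C X : Type*} : C → List (Step C X) → C
  | c, [] => c
  | _, e :: L => endpt e.dst L

/-- A list of consecutive steps starting at a given colour. -/
def IsPath {C X : Type*} (A : C → Setoid X) (D : Finset C) (p : C → Bool → X) :
    C → List (Step C X) → Prop
  | _, [] => True
  | c, e :: L => e.src = c ∧ IsStep A D p e ∧ IsPath A D p e.dst L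

section

variable {C X : Type*} {A : C → Setoid X} {D : Finset C} {p : C → Bool → X}

theorem IsStep.lab_inj {e : Step C X} (he : IsStep A D p e) {s t : Bool}
    (h : e.lab s = e.lab t) : s = t := by
  have h₁ := he.lab_ne
  cases s <;> cases t <;> simp_all

theorem endpt_append (c : C) (L L' : List (Step C X)) :
    endpt c (L ++ L') = endpt (endpt c L) L' := by
  induction L generalizing c with
  | nil => rfl
  | cons e L ih => exact ih _

theorem isPath_append {c : C} {L L' : List (Step C X)} :
    IsPath A D p c (L ++ L') ↔ IsPath A D p c L ∧ IsPath A D p (endpt c L) L' := by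
  induction L generalizing c with
  | nil => simp [IsPath, endpt]
  | cons e L ih => simp [IsPath, endpt, ih, and_assoc]

theorem IsPath.isStep {c : C} {L : List (Step C X)} (h : IsPath A D p c L) :
    ∀ e ∈ L, IsStep A D p e := by
  induction L generalizing c with
  | nil => simp
  | cons e L ih =>
    intro e' he'
    rcases List.mem_cons.1 he' with rfl | he'
    · exact h.2.1
    · exact ih h.2.2 e' he'

theorem IsPath.map_src {c : C} {L : List (Step C X)} (h : IsPath A D p c L) :
    L.map Step.src ++ [endpt c L] = c :: L.map Step.dst := by
  induction L generalizing c with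
  | nil => rfl
  | cons e L ih => simp [endpt, h.1, ih h.2.2]

theorem lab_eq_of_pairwise {L : List (Step C X)} (hL : L.Pairwise Indep)
    (hs : ∀ e ∈ L, IsStep A D p e) :
    ∀ i ∈ L, ∀ j ∈ L, ∀ s t, i.lab s = j.lab t → i = j ∧ s = t := by
  intro i hi j hj s t h
  by_cases hij : i = j
  · subst hij
    exact ⟨rfl, (hs i hi).lab_inj h⟩
  · have : Std.Symm (Indep (C := C) (X := X)) :=
      ⟨fun a b hab => ⟨hab.1.symm, fun s t => (hab.2 t s).symm⟩⟩
    exact absurd h ((hL.forall hi hj hij).2 s t)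

theorem dst_eq_of_pairwise {L : List (Step C X)} (hL : L.Pairwise Indep) :
    ∀ i ∈ L, ∀ j ∈ L, i.dst = j.dst → i = j := by
  intro i hi j hj h
  by_contra hij
  have : Std.Symm (Indep (C := C) (X := X)) :=
      ⟨fun a b hab => ⟨hab.1.symm, fun s t => (hab.2 t s).symm⟩⟩
  exact (hL.forall hi hj hij).1 h

/-- Recolouring the matching edges with colours in `W`, together with a new colour. -/
theorem IsRainbow.augment [DecidableEq C] (hp : IsRainbow A D p) {c₀ : C} (W : Set C)
    (r : C → Bool → X) (h₀ : c₀ ∈ W) (hrel : ∀ c ∈ W, (A c).r (r c true) (r c false))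
    (hinj : ∀ c ∈ W, ∀ d ∈ W, ∀ s t, r c s = r d t → c = d ∧ s = t)
    (hr : ∀ c ∈ W, ∀ t, ∀ d ∈ D, ∀ s, r c t = p d s → d ∈ W) :
    ∃ q, IsRainbow A (insert c₀ D) q := by
  classical
  refine ⟨fun c => if c ∈ W then r c else p c, ?_, ?_⟩
  · intro d hd
    by_cases hW : d ∈ W
    · simpa [hW] using hrel d hW
    · have : d ∈ D := by
        rcases Finset.mem_insert.1 hd with rfl | h
        · exact absurd h₀ hW
        · exact h
      simpa [hW] using hp.rel d this
  · have hD : ∀ d ∈ insert c₀ D, d ∉ W → d ∈ D := by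
      intro d hd hW
      rcases Finset.mem_insert.1 hd with rfl | h
      · exact absurd h₀ hW
      · exact h
    intro c hc d hd s t h
    by_cases hcW : c ∈ W <;> by_cases hdW : d ∈ W <;> simp only [hcW, hdW, if_true, if_false] at h
    · exact hinj c hcW d hdW s t h
    · exact absurd (hr c hcW s d (hD d hd hdW) t h) hdW
    · exact absurd (hr d hdW t c (hD c hc hcW) s h.symm) hcW
    · exact hp.inj c (hD c hc hcW) d (hD d hd hdW) s t h

theorem IsRainbow.augment_of_steps [DecidableEq C] (hp : IsRainbow A D p) {c₀ : C}
    (E : Set (Step C X)) (hE : ∀ e ∈ E, IsStep A D p e) (h₀ : ∃ e ∈ E, e.src = c₀)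
    (hsrc : ∀ e ∈ E, ∀ e' ∈ E, e.src = e'.src → e = e')
    (hdst : ∀ e ∈ E, ∃ e' ∈ E, e'.src = e.dst) (s : Step C X → Bool)
    (hs : ∀ e ∈ E, ∀ e' ∈ E, e.dst = e'.dst → s e = s e' → e = e')
    (hlab : ∀ e ∈ E, ∀ e' ∈ E, e.lab (s e) = e'.lab (s e') → e = e') :
    ∃ q, IsRainbow A (insert c₀ D) q := by
  classical
  have hex : ∀ c : C, ∃ f : Bool → X, ∀ e ∈ E, e.src = c →
      f true = p e.dst (s e) ∧ f false = e.lab (s e) := by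
    intro c
    by_cases h : ∃ e ∈ E, e.src = c
    · obtain ⟨e, he, hec⟩ := h
      refine ⟨fun t => if t then p e.dst (s e) else e.lab (s e), fun e' he' h' => ?_⟩
      obtain rfl := hsrc e he e' he' (hec.trans h'.symm)
      simp
    · obtain ⟨e, he, -⟩ := h₀
      exact ⟨e.lab, fun e' he' h' => absurd ⟨e', he', h'⟩ h⟩
  choose r hr using hex
  refine hp.augment (Step.src '' E) r h₀ ?_ ?_ ?_
  · rintro _ ⟨e, he, rfl⟩
    rw [(hr _ e he rfl).1, (hr _ e he rfl).2]
    exact (hE e he).rel _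
  · rintro _ ⟨e, he, rfl⟩ _ ⟨e', he', rfl⟩ a b h
    have h₁ := hr _ e he rfl
    have h₂ := hr _ e' he' rfl
    cases a <;> cases b <;> simp only [h₁, h₂] at h
    · rw [hlab e he e' he' h]
      simp
    · exact absurd h ((hE e he).free _ _ (hE e' he').dst_mem _)
    · exact absurd h.symm ((hE e' he').free _ _ (hE e he).dst_mem _)
    · obtain ⟨h₃, h₄⟩ := hp.inj _ (hE e he).dst_mem _ (hE e' he').dst_mem _ _ h
      rw [hs e he e' he' h₃ h₄]
      simp
  · rintro _ ⟨e, he, rfl⟩ a d hd b h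
    have h₁ := hr _ e he rfl
    cases a <;> simp only [h₁] at h
    · exact absurd h ((hE e he).free _ _ hd _)
    · obtain ⟨rfl, -⟩ := hp.inj _ (hE e he).dst_mem _ hd _ _ h
      exact hdst e he

/-- A missing colour reached by a path has no edge between unmatched vertices off the path. -/
theorem IsRainbow.augment_of_edge [DecidableEq C] (hp : IsRainbow A D p) {c₀ : C}
    (hc₀ : c₀ ∉ D) {σ : List (Step C X)} (hσ : IsPath A D p c₀ σ) (hi : σ.Pairwise Indep)
    {x y : X} (hxy : x ≠ y) (hr : (A (endpt c₀ σ)).r x y)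
    (hx : ∀ d ∈ D, ∀ t, x ≠ p d t) (hy : ∀ d ∈ D, ∀ t, y ≠ p d t)
    (hxσ : ∀ e ∈ σ, ∀ t, x ≠ e.lab t) (hyσ : ∀ e ∈ σ, ∀ t, y ≠ e.lab t) :
    ∃ q, IsRainbow A (insert c₀ D) q := by
  classical
  have hsteps := hσ.isStep
  have hnd : (σ.map Step.src ++ [endpt c₀ σ]).Nodup := by
    rw [hσ.map_src, List.nodup_cons]
    constructor
    · simp only [List.mem_map, not_exists, not_and]
      intro e he h
      exact hc₀ (h ▸ (hsteps e he).dst_mem)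
    · exact List.pairwise_map.2 (hi.imp fun h => h.1)
  have hmem : ∀ c, (c ∈ σ.map Step.src ∨ c = endpt c₀ σ) ↔ (c = c₀ ∨ c ∈ σ.map Step.dst) := by
    intro c
    have := congrArg (c ∈ ·) hσ.map_src
    simpa using this
  rw [List.nodup_append] at hnd
  have hsrc : ∀ e ∈ σ, ∀ e' ∈ σ, e.src = e'.src → e = e' := fun e he e' he' h =>
    List.inj_on_of_nodup_map hnd.1 he he' h
  have hend : ∀ e ∈ σ, e.src ≠ endpt c₀ σ := fun e he =>
    hnd.2.2 _ (List.mem_map_of_mem he) _ (by simp)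
  have hex : ∀ c : C, ∃ f : Bool → X, (c = endpt c₀ σ → f true = x ∧ f false = y) ∧
      ∀ e ∈ σ, e.src = c → f true = p e.dst true ∧ f false = e.lab true := by
    intro c
    by_cases hc : c = endpt c₀ σ
    · exact ⟨fun t => if t then x else y, by simp, fun e he h => absurd (h.trans hc) (hend e he)⟩
    by_cases h : ∃ e ∈ σ, e.src = c
    · obtain ⟨e, he, hec⟩ := h
      refine ⟨fun t => if t then p e.dst true else e.lab true, fun h => absurd h hc,
        fun e' he' h' => ?_⟩
      obtain rfl := hsrc e he e' he' (hec.trans h'.symm)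
      simp
    · exact ⟨fun _ => x, fun h => absurd h hc, fun e' he' h' => absurd ⟨e', he', h'⟩ h⟩
  choose r hr₁ hr₂ using hex
  have hlab := lab_eq_of_pairwise hi hsteps
  have hE := hr₁ _ rfl
  refine hp.augment {c | c ∈ σ.map Step.src ∨ c = endpt c₀ σ} r ((hmem c₀).2 (Or.inl rfl)) ?_ ?_ ?_
  · rintro c (hc | rfl)
    · obtain ⟨e, he, rfl⟩ := List.mem_map.1 hc
      rw [(hr₂ _ e he rfl).1, (hr₂ _ e he rfl).2]
      exact (hsteps e he).rel _
    · rw [hE.1, hE.2]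
      exact hr
  · rintro c (hc | rfl) d (hd | rfl) a b h
    · obtain ⟨e, he, rfl⟩ := List.mem_map.1 hc
      obtain ⟨e', he', rfl⟩ := List.mem_map.1 hd
      have h₁ := hr₂ _ e he rfl
      have h₂ := hr₂ _ e' he' rfl
      cases a <;> cases b <;> simp only [h₁, h₂] at h
      · rw [(hlab e he e' he' _ _ h).1]
        simp
      · exact absurd h ((hsteps e he).free _ _ (hsteps e' he').dst_mem _)
      · exact absurd h.symm ((hsteps e' he').free _ _ (hsteps e he).dst_mem _)
      · obtain ⟨h₃, -⟩ := hp.inj _ (hsteps e he).dst_mem _ (hsteps e' he').dst_mem _ _ h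
        rw [dst_eq_of_pairwise hi e he e' he' h₃]
        simp
    · obtain ⟨e, he, rfl⟩ := List.mem_map.1 hc
      have h₁ := hr₂ _ e he rfl
      cases a <;> cases b <;> simp only [h₁, hE] at h
      · exact absurd h.symm (hyσ e he _)
      · exact absurd h.symm (hxσ e he _)
      · exact absurd h.symm (hy _ (hsteps e he).dst_mem _)
      · exact absurd h.symm (hx _ (hsteps e he).dst_mem _)
    · obtain ⟨e, he, rfl⟩ := List.mem_map.1 hd
      have h₁ := hr₂ _ e he rfl
      cases a <;> cases b <;> simp only [h₁, hE] at h
      · exact absurd h (hyσ e he _)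
      · exact absurd h (hy _ (hsteps e he).dst_mem _)
      · exact absurd h (hxσ e he _)
      · exact absurd h (hx _ (hsteps e he).dst_mem _)
    · cases a <;> cases b <;> simp only [hE] at h
      · simp
      · exact absurd h.symm hxy
      · exact absurd h hxy
      · simp
  · rintro c (hc | rfl) a d hd b h
    · obtain ⟨e, he, rfl⟩ := List.mem_map.1 hc
      have h₁ := hr₂ _ e he rfl
      cases a <;> simp only [h₁] at h
      · exact absurd h ((hsteps e he).free _ _ hd _)
      · obtain ⟨rfl, -⟩ := hp.inj _ (hsteps e he).dst_mem _ hd _ _ h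
        exact (hmem _).2 (Or.inr (List.mem_map_of_mem he))
    · cases a <;> simp only [hE] at h
      · exact absurd h (hy _ hd _)
      · exact absurd h (hx _ hd _)

/-- Two families of pairwise disjoint pairs have a common system of distinct representatives,
which can be chosen to avoid an element not covered by the second family. -/
theorem exists_selection {ι X : Type*} (S₁ S₂ : Finset ι) (φ : ι → Bool → X)
    (h₁ : ∀ i ∈ S₁, ∀ j ∈ S₁, ∀ s t, φ i s = φ j t → i = j ∧ s = t)
    (h₂ : ∀ i ∈ S₂, ∀ j ∈ S₂, ∀ s t, φ i s = φ j t → i = j ∧ s = t)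
    (x : X) (hx : ∀ i ∈ S₂, ∀ t, φ i t ≠ x) :
    ∃ s : ι → Bool, (∀ i, i ∈ S₁ ∨ i ∈ S₂ → φ i (s i) ≠ x) ∧
      ∀ i, i ∈ S₁ ∨ i ∈ S₂ → ∀ j, j ∈ S₁ ∨ j ∈ S₂ → φ i (s i) = φ j (s j) → i = j := by
  classical
  let ι' := {i // i ∈ S₁ ∪ S₂}
  let T : ι' → Finset X := fun i => (Finset.univ.image (φ i)).erase x
  have hcard : ∀ S U : Finset ι, (∀ i ∈ S, i ∈ U) →
      (∀ i ∈ U, ∀ j ∈ U, ∀ s t, φ i s = φ j t → i = j ∧ s = t) →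
      ((S ×ˢ (Finset.univ : Finset Bool)).image fun q => φ q.1 q.2).card = 2 * S.card := by
    intro S U hSU hU
    rw [Finset.card_image_of_injOn, Finset.card_product]
    · simp [mul_comm]
    · rintro ⟨i, s⟩ hi ⟨j, t⟩ hj h
      simp only [Finset.coe_product, Set.mem_prod, Finset.mem_coe] at hi hj
      obtain ⟨rfl, rfl⟩ := hU i (hSU i hi.1) j (hSU j hj.1) s t h
      rfl
  have hall : ∀ S : Finset ι', S.card ≤ (S.biUnion T).card := by
    intro S
    let R := S.image Subtype.val
    have hR : R.card = S.card := Finset.card_image_of_injective _ Subtype.val_injective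
    have hsub : ∀ i ∈ R, ∀ t, φ i t ≠ x → φ i t ∈ S.biUnion T := by
      intro i hi t ht
      obtain ⟨i', hi', rfl⟩ := Finset.mem_image.1 hi
      exact Finset.mem_biUnion.2 ⟨i', hi', Finset.mem_erase.2
        ⟨ht, Finset.mem_image_of_mem _ (Finset.mem_univ t)⟩⟩
    have hRU : R ⊆ (R ∩ S₁) ∪ (R ∩ S₂) := by
      intro i hi
      obtain ⟨i', hi', rfl⟩ := Finset.mem_image.1 hi
      have := Finset.mem_union.1 i'.2
      simp only [Finset.mem_union, Finset.mem_inter]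
      tauto
    have hle := (Finset.card_le_card hRU).trans (Finset.card_union_le _ _)
    have c₁ := hcard (R ∩ S₁) S₁ (fun i hi => (Finset.mem_inter.1 hi).2) h₁
    have c₂ := hcard (R ∩ S₂) S₂ (fun i hi => (Finset.mem_inter.1 hi).2) h₂
    have d₁ : (((R ∩ S₁) ×ˢ (Finset.univ : Finset Bool)).image fun q => φ q.1 q.2).card ≤
        (S.biUnion T).card + 1 := by
      refine Nat.sub_le_iff_le_add.1 ((Finset.pred_card_le_card_erase (a := x)).trans
        (Finset.card_le_card ?_))
      intro y hy
      obtain ⟨hyx, hy⟩ := Finset.mem_erase.1 hy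
      obtain ⟨q, hq, rfl⟩ := Finset.mem_image.1 hy
      exact hsub _ (Finset.mem_inter.1 (Finset.mem_product.1 hq).1).1 _ hyx
    have d₂ : (((R ∩ S₂) ×ˢ (Finset.univ : Finset Bool)).image fun q => φ q.1 q.2).card ≤
        (S.biUnion T).card := by
      refine Finset.card_le_card ?_
      intro y hy
      obtain ⟨q, hq, rfl⟩ := Finset.mem_image.1 hy
      have hq' := Finset.mem_inter.1 (Finset.mem_product.1 hq).1
      exact hsub _ hq'.1 _ (hx _ hq'.2 _)
    omega
  obtain ⟨f, hf, hfT⟩ := (Finset.all_card_le_biUnion_card_iff_exists_injective T).1 hall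
  have hex : ∀ i, ∃ t : Bool, ∀ h : i ∈ S₁ ∪ S₂, φ i t = f ⟨i, h⟩ := by
    intro i
    by_cases h : i ∈ S₁ ∪ S₂
    · obtain ⟨-, h'⟩ := Finset.mem_erase.1 (hfT ⟨i, h⟩)
      obtain ⟨t, -, ht⟩ := Finset.mem_image.1 h'
      exact ⟨t, fun _ => ht⟩
    · exact ⟨true, fun h' => absurd h' h⟩
  choose s hs using hex
  refine ⟨s, fun i hi => ?_, fun i hi j hj h => ?_⟩
  · rw [hs i (Finset.mem_union.2 hi)]
    exact (Finset.mem_erase.1 (hfT _)).1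
  · rw [hs i (Finset.mem_union.2 hi), hs j (Finset.mem_union.2 hj)] at h
    exact congrArg Subtype.val (hf h)

/-- A path that returns to a matching edge it has already switched yields a larger matching. -/
theorem IsRainbow.augment_of_return [DecidableEq C] (hp : IsRainbow A D p) {c₀ : C}
    (hc₀ : c₀ ∉ D) {P Q : List (Step C X)} {e z : Step C X}
    (hpath : IsPath A D p c₀ (P ++ Q ++ [z])) (he : e ∈ P) (hez : z.dst = e.dst)
    (hP : P.Pairwise Indep) (hQ : (Q ++ [z]).Pairwise Indep)
    (hPQ : ∀ i ∈ P, ∀ j ∈ Q, i.dst ≠ j.dst)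
    (hav : ∀ i ∈ Q, ∀ s t, i.lab s ≠ e.lab t) (hcross : ¬ ∀ t, z.lab t = e.lab (!t)) :
    ∃ q, IsRainbow A (insert c₀ D) q := by
  classical
  obtain ⟨t, ht⟩ := not_forall.1 hcross
  have hsteps := hpath.isStep
  have hPs : ∀ i ∈ P, IsStep A D p i := fun i hi => hsteps i (by simp [hi])
  have hQs : ∀ i ∈ Q ++ [z], IsStep A D p i := fun i hi => hsteps i (by
    simp only [List.mem_append] at hi ⊢; tauto)
  have hdst : ((P ++ Q).map Step.dst).Nodup := by
    rw [List.map_append, List.nodup_append]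
    refine ⟨List.pairwise_map.2 (hP.imp fun h => h.1),
      List.pairwise_map.2 ((List.pairwise_append.1 hQ).1.imp fun h => h.1), ?_⟩
    intro a ha b hb
    obtain ⟨i, hi, rfl⟩ := List.mem_map.1 ha
    obtain ⟨j, hj, rfl⟩ := List.mem_map.1 hb
    exact hPQ i hi j hj
  have hsrcs : (P ++ Q ++ [z]).map Step.src = c₀ :: (P ++ Q).map Step.dst := by
    have := hpath.map_src
    rw [endpt_append, List.map_append (f := Step.dst), ← List.cons_append] at this
    exact (List.append_inj' this rfl).1
  have hsrc_nd : ((P ++ Q ++ [z]).map Step.src).Nodup := by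
    rw [hsrcs, List.nodup_cons]
    refine ⟨?_, hdst⟩
    simp only [List.mem_map, not_exists, not_and]
    intro i hi h
    exact hc₀ (h ▸ (hsteps i (List.mem_append_left _ hi)).dst_mem)
  have hnd := hsrc_nd.of_map
  have hzPQ : z ∉ P ++ Q := fun h => (List.nodup_append.1 hnd).2.2 z h z (by simp) rfl
  have hzP : z ∉ P := fun h => hzPQ (List.mem_append_left _ h)
  have hzQ : z ∉ Q := fun h => hzPQ (List.mem_append_right _ h)
  have hPl := lab_eq_of_pairwise hP hPs
  have hQl := lab_eq_of_pairwise hQ hQs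
  obtain ⟨s₀, hs₁, hs₂⟩ := exists_selection (P.toFinset.erase e) Q.toFinset Step.lab
    (fun i hi j hj => hPl i (by simp at hi; exact hi.2) j (by simp at hj; exact hj.2))
    (fun i hi j hj => hQl i (by simp at hi; simp [hi]) j (by simp at hj; simp [hj])) (z.lab t)
    (fun i hi s h => hzQ (by
      simp only [List.mem_toFinset] at hi
      obtain ⟨rfl, -⟩ := hQl i (by simp [hi]) z (by simp) s t h
      exact hi))
  have hze : z ≠ e := fun h => hzP (h ▸ he)
  have hcases : ∀ i ∈ P ++ Q ++ [z], i ≠ z → i ≠ e → i ∈ P.toFinset.erase e ∨ i ∈ Q.toFinset := by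
    intro i hi h₁ h₂
    simp only [List.mem_append, List.mem_singleton] at hi
    simp only [Finset.mem_erase, List.mem_toFinset]
    tauto
  have hmemcases : ∀ i ∈ P ++ Q ++ [z], i ≠ z → i ∈ P ++ Q := by
    intro i hi h₁
    simp only [List.mem_append, List.mem_singleton] at hi ⊢
    tauto
  let s : Step C X → Bool := fun i => if i = z then t else if i = e then !t else s₀ i
  have hsz : s z = t := by simp [s]
  have hse : s e = !t := by simp [s, hze.symm]
  have hso : ∀ i, i ≠ z → i ≠ e → s i = s₀ i := fun i h₁ h₂ => by simp [s, h₁, h₂]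
  have hzi : ∀ i ∈ P ++ Q ++ [z], i ≠ z → z.lab (s z) ≠ i.lab (s i) := by
    intro i hi h₁ h
    rw [hsz] at h
    by_cases h₂ : i = e
    · subst h₂
      rw [hse] at h
      exact ht h
    · rw [hso i h₁ h₂] at h
      exact hs₁ i (hcases i hi h₁ h₂) h.symm
  have hei : ∀ i ∈ P ++ Q ++ [z], i ≠ z → i ≠ e → e.lab (s e) ≠ i.lab (s i) := by
    intro i hi h₁ h₂ h
    rcases List.mem_append.1 (hmemcases i hi h₁) with h' | h'
    · exact h₂ (hPl e he i h' _ _ h).1.symm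
    · exact hav i h' _ _ h.symm
  have hePQ : e ∈ P ++ Q := List.mem_append_left _ he
  refine hp.augment_of_steps {i | i ∈ P ++ Q ++ [z]} hsteps ?_ ?_ ?_ s ?_ ?_
  · have : c₀ ∈ (P ++ Q ++ [z]).map Step.src := by rw [hsrcs]; exact List.mem_cons_self
    exact List.mem_map.1 this
  · exact fun i hi j hj h => List.inj_on_of_nodup_map hsrc_nd hi hj h
  · intro i hi
    have : i.dst ∈ (P ++ Q ++ [z]).map Step.src := by
      rw [hsrcs]
      refine List.mem_cons_of_mem _ ?_
      by_cases h : i = z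
      · rw [h, hez]
        exact List.mem_map_of_mem hePQ
      · exact List.mem_map_of_mem (hmemcases i hi h)
    exact List.mem_map.1 this
  · have key : ∀ i ∈ P ++ Q ++ [z], i ≠ z → z.dst = i.dst → s z = s i → False := by
      intro i hi h₁ h₂ h₃
      have : e = i := List.inj_on_of_nodup_map hdst hePQ (hmemcases i hi h₁) (hez.symm.trans h₂)
      rw [hsz, ← this, hse] at h₃
      cases t <;> simp at h₃
    intro i hi j hj h₁ h₂
    by_cases hiz : i = z <;> by_cases hjz : j = z
    · rw [hiz, hjz]
    · subst hiz
      exact (key j hj hjz h₁ h₂).elim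
    · subst hjz
      exact (key i hi hiz h₁.symm h₂.symm).elim
    · exact List.inj_on_of_nodup_map hdst (hmemcases i hi hiz) (hmemcases j hj hjz) h₁
  · intro i hi j hj h
    by_cases hiz : i = z <;> by_cases hjz : j = z
    · rw [hiz, hjz]
    · subst hiz
      exact (hzi j hj hjz h).elim
    · subst hjz
      exact (hzi i hi hiz h.symm).elim
    by_cases hie : i = e <;> by_cases hje : j = e
    · rw [hie, hje]
    · subst hie
      exact (hei j hj hjz hje h).elim
    · subst hje
      exact (hei i hi hiz hie h.symm).elim
    · rw [hso i hiz hie, hso j hjz hje] at h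
      exact hs₂ i (hcases i hi hiz hie) j (hcases j hj hjz hje) h

/-- The path `σ` can be continued to the matching edge switched by `e`, avoiding the unmatched
vertices of `e` before the last step and without swapping them in the last step. -/
def Reach (A : C → Setoid X) (D : Finset C) (p : C → Bool → X) (c₀ : C)
    (σ : List (Step C X)) (e : Step C X) : Prop :=
  ∃ l z, IsPath A D p c₀ (σ ++ l ++ [z]) ∧ (σ ++ l ++ [z]).Pairwise Indep ∧ z.dst = e.dst ∧
    (∀ i ∈ l, ∀ s t, i.lab s ≠ e.lab t) ∧ ¬ ∀ t, z.lab t = e.lab (!t)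

theorem IsRainbow.augment_of_reach_of_reach [DecidableEq C] (hp : IsRainbow A D p) {c₀ : C}
    (hc₀ : c₀ ∉ D) {σ : List (Step C X)} {a b : Step C X}
    (hab : Reach A D p c₀ (σ ++ [a]) b) (hba : Reach A D p c₀ (σ ++ [b]) a) :
    ∃ q, IsRainbow A (insert c₀ D) q := by
  classical
  obtain ⟨l, z, hl, hli, hzb, hav, hcross⟩ := hab
  obtain ⟨m, y, hm, hmi, hya, -, -⟩ := hba
  obtain ⟨i, hi⟩ : ∃ i, (m ++ [y]).find? (fun i => decide (i.dst ∈ (a :: l).map Step.dst)) =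
      some i := by
    refine Option.isSome_iff_exists.1 (List.find?_isSome.2 ⟨y, by simp, by simp [hya]⟩)
  obtain ⟨hia, q₁, q₂, hq, hq₁⟩ := List.find?_eq_some_iff_append.1 hi
  obtain ⟨j, hj, hji⟩ := List.mem_map.1 (of_decide_eq_true hia)
  obtain ⟨l₁, l₂, hl₁₂⟩ := List.append_of_mem hj
  have hl' : σ ++ [a] ++ l ++ [z] = (σ ++ l₁ ++ [j]) ++ (l₂ ++ [z]) := by
    have : σ ++ [a] ++ l ++ [z] = σ ++ (a :: l) ++ [z] := by simp
    rw [this, hl₁₂]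
    simp
  have hm' : σ ++ [b] ++ m ++ [y] = (σ ++ [b] ++ q₁ ++ [i]) ++ q₂ := by
    have : σ ++ [b] ++ m ++ [y] = σ ++ [b] ++ (m ++ [y]) := by simp
    rw [this, hq]
    simp
  have hsub : ∀ k ∈ l₂, k ∈ a :: l := fun k hk => by rw [hl₁₂]; simp [hk]
  rw [hl'] at hl hli
  rw [hm'] at hm hmi
  have hal : l₂ ⊆ l := by
    intro k hk
    cases l₁ with
    | nil =>
      simp only [List.nil_append, List.cons.injEq] at hl₁₂
      rw [hl₁₂.2]
      exact hk
    | cons x l₁ =>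
      simp only [List.cons_append, List.cons.injEq] at hl₁₂
      rw [hl₁₂.2]
      simp [hk]
  refine hp.augment_of_return hc₀ (P := σ ++ [b] ++ q₁ ++ [i]) (Q := l₂) (e := b) (z := z)
    ?_ (by simp) hzb (List.pairwise_append.1 hmi).1 (List.pairwise_append.1 hli).2.1 ?_
    (fun k hk => hav k (hal hk)) hcross
  · rw [List.append_assoc, isPath_append]
    refine ⟨(isPath_append.1 hm).1, ?_⟩
    have := (isPath_append.1 hl).2
    rw [endpt_append] at this ⊢
    simpa [endpt, hji] using this
  · intro k hk k' hk'
    have hlp := (List.pairwise_append.1 hli).2.2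
    simp only [List.mem_append, List.mem_singleton] at hk
    rcases hk with ((hk | rfl) | hk) | rfl
    · exact (hlp k (by simp [hk]) k' (by simp [hk'])).1
    · rw [← hzb]
      have hlz := (List.pairwise_append.1 (List.pairwise_append.1 hli).2.1).2.2
      exact (hlz k' hk' z (by simp)).1.symm
    · intro h
      have := hq₁ k hk
      simp only [Bool.not_eq_true', decide_eq_false_iff_not] at this
      exact this (h ▸ List.mem_map_of_mem (hsub k' hk'))
    · rw [← hji]
      exact (hlp j (by simp) k' (by simp [hk'])).1

/-- The unmatched vertices used by a list of steps. -/
noncomputable def labels (L : List (Step C X)) : Finset X := by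
  classical exact (L.toFinset ×ˢ (Finset.univ : Finset Bool)).image fun q => q.1.lab q.2

theorem mem_labels {L : List (Step C X)} {x : X} : x ∈ labels L ↔ ∃ e ∈ L, ∃ t, e.lab t = x := by
  classical
  simp only [labels, Finset.mem_image, Finset.mem_product, List.mem_toFinset, Finset.mem_univ,
    and_true, Prod.exists, exists_and_left]

theorem card_labels_le (L : List (Step C X)) : (labels L).card ≤ 2 * L.length := by
  classical
  refine Finset.card_image_le.trans ?_
  rw [Finset.card_product, mul_comm]
  simpa using L.toFinset_card_le

/-- If no larger matching exists, then a path can be continued to many matching edges, using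
different unmatched vertices for each of them. -/
theorem IsRainbow.exists_steps [DecidableEq C] (hp : IsRainbow A D p) {c₀ : C} (hc₀ : c₀ ∉ D)
    (hmax : ¬ ∃ q, IsRainbow A (insert c₀ D) q) {σ : List (Step C X)}
    (hσ : IsPath A D p c₀ σ) (hi : σ.Pairwise Indep) {K : Finset X}
    (hK : ∀ x ∈ K, ∃ z, z ≠ x ∧ (A (endpt c₀ σ)).r x z) :
    ∃ (S : Finset C) (e : C → Step C X), S ⊆ D ∧
      K.card ≤ S.card + 3 * D.card + 5 * σ.length ∧
      (∀ b ∈ S, (e b).dst = b ∧ IsPath A D p c₀ (σ ++ [e b]) ∧ (σ ++ [e b]).Pairwise Indep) ∧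
      ∀ b ∈ S, ∀ b' ∈ S, ∀ s t, (e b).lab s = (e b').lab t → b = b' := by
  classical
  set u := endpt c₀ σ with hu
  let V : Finset X := (D ×ˢ (Finset.univ : Finset Bool)).image fun q => p q.1 q.2
  have hV : ∀ x, x ∈ V ↔ ∃ d ∈ D, ∃ t, p d t = x := by
    intro x
    simp only [V, Finset.mem_image, Finset.mem_product, Finset.mem_univ, and_true, Prod.exists,
      exists_and_left]
  have hVcard : V.card ≤ 2 * D.card := by
    refine Finset.card_image_le.trans ?_
    rw [Finset.card_product, mul_comm]
    simp
  let G := (K \ V) \ labels σ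
  have hGfree : ∀ x, x ∉ V → ∀ d ∈ D, ∀ t, x ≠ p d t := fun x hx d hd t h =>
    hx ((hV x).2 ⟨d, hd, t, h.symm⟩)
  have hGlab : ∀ x, x ∉ labels σ → ∀ e ∈ σ, ∀ t, x ≠ e.lab t := fun x hx e he t h =>
    hx (mem_labels.2 ⟨e, he, t, h.symm⟩)
  have hno : ∀ x y, x ∉ V → y ∉ V → x ∉ labels σ → y ∉ labels σ → (A u).r x y → x = y := by
    intro x y hx hy hx' hy' h
    by_contra hxy
    exact hmax (hp.augment_of_edge hc₀ hσ hi hxy h (hGfree x hx) (hGfree y hy) (hGlab x hx')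
      (hGlab y hy'))
  have hGmem : ∀ x ∈ G, x ∈ K ∧ x ∉ V ∧ x ∉ labels σ := by
    intro x hx
    simpa [G, and_assoc] using hx
  have hg : ∀ x, ∃ y, x ∈ G → (y ∈ V ∨ y ∈ labels σ) ∧ (A u).r y x := by
    intro x
    by_cases hx : x ∈ G
    · obtain ⟨hxK, hxV, hxL⟩ := hGmem x hx
      obtain ⟨z, hzx, hz⟩ := hK x hxK
      refine ⟨z, fun _ => ⟨?_, (A u).symm hz⟩⟩
      by_contra! h
      exact hzx (hno x z hxV h.1 hxL h.2 hz).symm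
    · exact ⟨x, fun h => absurd h hx⟩
  choose g hg using hg
  have hginj : Set.InjOn g G := by
    intro x hx y hy h
    obtain ⟨-, hxV, hxL⟩ := hGmem x hx
    obtain ⟨-, hyV, hyL⟩ := hGmem y hy
    have h₁ := (hg x hx).2
    rw [h] at h₁
    exact hno x y hxV hyV hxL hyL ((A u).trans ((A u).symm h₁) (hg y hy).2)
  let H := (G.image g).filter (· ∈ V)
  have hGcard : K.card ≤ G.card + V.card + (labels σ).card := by
    have h₁ := Finset.le_card_sdiff V K
    have h₂ := Finset.le_card_sdiff (labels σ) (K \ V)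
    change _ ≤ G.card at h₂
    omega
  have hHcard : G.card ≤ H.card + (labels σ).card := by
    rw [← Finset.card_image_of_injOn hginj]
    refine (Finset.card_le_card ?_).trans (Finset.card_union_le H (labels σ))
    intro y hy
    obtain ⟨x, hx, rfl⟩ := Finset.mem_image.1 hy
    rcases (hg x hx).1 with h | h
    · exact Finset.mem_union_left _ (Finset.mem_filter.2 ⟨hy, h⟩)
    · exact Finset.mem_union_right _ h
  let HB : Bool → Finset C := fun t => D.filter fun d => p d t ∈ H
  have hHB : H.card ≤ (HB true).card + (HB false).card := by
    have : H ⊆ (HB true).image (fun d => p d true) ∪ (HB false).image (fun d => p d false) := by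
      intro y hy
      obtain ⟨d, hd, t, rfl⟩ := (hV y).1 (Finset.mem_filter.1 hy).2
      cases t
      · exact Finset.mem_union_right _ (Finset.mem_image_of_mem _ (Finset.mem_filter.2 ⟨hd, hy⟩))
      · exact Finset.mem_union_left _
          (Finset.mem_image_of_mem (fun d => p d true) (Finset.mem_filter.2 ⟨hd, hy⟩))
    exact (Finset.card_le_card this).trans ((Finset.card_union_le _ _).trans
      (Nat.add_le_add Finset.card_image_le Finset.card_image_le))
  have hHB' : (HB true).card + (HB false).card ≤ D.card + (HB true ∩ HB false).card := by
    rw [← Finset.card_union_add_card_inter]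
    exact Nat.add_le_add_right (Finset.card_le_card (Finset.union_subset
      (Finset.filter_subset _ _) (Finset.filter_subset _ _))) _
  let S := (HB true ∩ HB false) \ (σ.map Step.dst).toFinset
  have hS : (HB true ∩ HB false).card ≤ S.card + σ.length := by
    have h₁ := Finset.le_card_sdiff (σ.map Step.dst).toFinset (HB true ∩ HB false)
    have h₂ := (σ.map Step.dst).toFinset_card_le
    rw [List.length_map] at h₂
    change _ ≤ S.card at h₁
    omega
  have hlab : ∀ d t, ∃ x, d ∈ S → x ∈ G ∧ g x = p d t := by
    intro d t
    by_cases hd : d ∈ S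
    · have : p d t ∈ H := by
        have h := (Finset.mem_sdiff.1 hd).1
        cases t
        · exact (Finset.mem_filter.1 (Finset.mem_inter.1 h).2).2
        · exact (Finset.mem_filter.1 (Finset.mem_inter.1 h).1).2
      obtain ⟨x, hx, hx'⟩ := Finset.mem_image.1 (Finset.mem_filter.1 this).1
      exact ⟨x, fun _ => ⟨hx, hx'⟩⟩
    · exact ⟨p d t, fun h => absurd h hd⟩
  choose lab hlab using hlab
  have hSD : S ⊆ D := fun d hd =>
    (Finset.mem_filter.1 (Finset.mem_inter.1 (Finset.mem_sdiff.1 hd).1).1).1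
  have hinj : ∀ b ∈ S, ∀ b' ∈ S, ∀ s t, lab b s = lab b' t → b = b' ∧ s = t := by
    intro b hb b' hb' s t h
    refine hp.inj b (hSD hb) b' (hSD hb') s t ?_
    rw [← (hlab b s hb).2, ← (hlab b' t hb').2, h]
  refine ⟨S, fun d => ⟨u, d, lab d⟩, hSD, ?_, ?_, fun b hb b' hb' s t h =>
    (hinj b hb b' hb' s t h).1⟩
  · have := card_labels_le σ
    omega
  · intro b hb
    refine ⟨rfl, isPath_append.2 ⟨hσ, hu.symm ▸ rfl, ?_, trivial⟩, ?_⟩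
    · refine ⟨hSD hb, fun t => ?_, fun t => ?_, fun h => ?_⟩
      · exact fun d hd s => hGfree _ (hGmem _ (hlab b t hb).1).2.1 d hd s
      · change (A u).r (p b t) (lab b t)
        rw [← (hlab b t hb).2]
        exact (hg _ (hlab b t hb).1).2
      · simpa using (hinj b hb b hb _ _ h).2
    · refine List.pairwise_append.2 ⟨hi, List.pairwise_singleton _ _, ?_⟩
      intro i hi' j hj
      rw [List.mem_singleton] at hj
      subst hj
      refine ⟨fun h => ?_, fun s t h => ?_⟩
      · refine (Finset.mem_sdiff.1 hb).2 ?_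
        rw [List.mem_toFinset]
        change i.dst = b at h
        exact h ▸ List.mem_map_of_mem hi'
      · exact hGlab _ (hGmem _ (hlab b t hb).1).2.2 i hi' s h.symm

/-- An antisymmetric relation on a finite set has an element related to at most half of the
other elements. -/
theorem exists_card_le_two_mul_card_not {ι : Type*} [DecidableEq ι] (S : Finset ι)
    (hS : S.Nonempty) (R : ι → ι → Prop) [DecidableRel R] (hR : ∀ a ∈ S, ∀ b ∈ S, R a b → ¬ R b a) :
    ∃ a ∈ S, S.card ≤ 2 * ((S.erase a).filter fun b => ¬ R a b).card + 1 := by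
  by_contra! h
  have h₁ : ∀ a ∈ S, S.card ≤ ((S.erase a).filter fun b => ¬ R a b).card +
      ((S.erase a).filter fun b => ¬ R b a).card + 1 := by
    intro a ha
    rw [← Finset.card_erase_add_one ha]
    refine Nat.add_le_add_right ((Finset.card_le_card fun b hb => ?_).trans
      (Finset.card_union_le _ _)) 1
    simp only [Finset.mem_union, Finset.mem_filter, hb, true_and]
    have := hR a ha b (Finset.mem_of_mem_erase hb)
    tauto
  have h₂ : ∑ a ∈ S, ((S.erase a).filter fun b => ¬ R a b).card =
      ∑ a ∈ S, ((S.erase a).filter fun b => ¬ R b a).card := by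
    have := Finset.sum_card_bipartiteAbove_eq_sum_card_bipartiteBelow (s := S) (t := S)
      (fun a b => b ≠ a ∧ ¬ R a b)
    convert this using 4 with a ha b hb
    · ext b
      simp only [Finset.mem_filter, Finset.mem_erase, Finset.bipartiteAbove]
      tauto
    · ext b
      simp only [Finset.mem_filter, Finset.mem_erase, Finset.bipartiteBelow, ne_comm (a := b)]
      tauto
  have h₃ := Finset.sum_le_sum h₁
  have h₄ := Finset.sum_lt_sum_of_nonempty hS h
  simp only [Finset.sum_add_distrib, ← Finset.mul_sum] at h₃ h₄
  omega

theorem IsRainbow.exists_extension [DecidableEq C] (hp : IsRainbow A D p) {c₀ : C}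
    (hc₀ : c₀ ∉ D) (hmax : ¬ ∃ q, IsRainbow A (insert c₀ D) q) {σ : List (Step C X)}
    (hσ : IsPath A D p c₀ σ) (hi : σ.Pairwise Indep) {K : Finset X}
    (hK : ∀ x ∈ K, ∃ z, z ≠ x ∧ (A (endpt c₀ σ)).r x z)
    (hcard : 3 * D.card + 5 * σ.length < K.card) :
    ∃ (a : Step C X) (B : Finset C) (e : C → Step C X),
      IsPath A D p c₀ (σ ++ [a]) ∧ (σ ++ [a]).Pairwise Indep ∧ B ⊆ D ∧
      K.card ≤ 2 * B.card + 1 + 3 * D.card + 5 * σ.length ∧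
      (∀ b ∈ B, (e b).dst = b ∧ IsPath A D p c₀ (σ ++ [e b]) ∧ (σ ++ [e b]).Pairwise Indep ∧
        ¬ Reach A D p c₀ (σ ++ [a]) (e b)) ∧
      ∀ b ∈ B, ∀ b' ∈ B, ∀ s t, (e b).lab s = (e b').lab t → b = b' := by
  classical
  obtain ⟨S, e, hSD, hSc, he, hinj⟩ := hp.exists_steps hc₀ hmax hσ hi hK
  obtain ⟨a, ha, haS⟩ := exists_card_le_two_mul_card_not S (Finset.card_pos.1 (by omega))
    (fun a b => Reach A D p c₀ (σ ++ [e a]) (e b)) fun a _ b _ hab hba =>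
      hmax (hp.augment_of_reach_of_reach hc₀ hab hba)
  have hB : ∀ b ∈ (S.erase a).filter fun b => ¬ Reach A D p c₀ (σ ++ [e a]) (e b), b ∈ S :=
    fun b hb => Finset.mem_of_mem_erase (Finset.mem_filter.1 hb).1
  refine ⟨e a, _, e, (he a ha).2.1, (he a ha).2.2, fun b hb => hSD (hB b hb), ?_,
    fun b hb => ⟨(he b (hB b hb)).1, (he b (hB b hb)).2.1, (he b (hB b hb)).2.2,
      (Finset.mem_filter.1 hb).2⟩,
    fun b hb b' hb' => hinj b (hB b hb) b' (hB b' hb')⟩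
  omega

/-- If no larger matching exists, then there is a long path such that each of its initial segments
can be continued to many matching edges that the next longer segment does not reach. -/
theorem IsRainbow.exists_long_path [DecidableEq C] (hp : IsRainbow A D p) {c₀ : C}
    (hc₀ : c₀ ∉ D) (hmax : ¬ ∃ q, IsRainbow A (insert c₀ D) q) {K : C → Finset X} {N : ℕ}
    (hK : ∀ c, ∀ x ∈ K c, ∃ z, z ≠ x ∧ (A c).r x z) (hN : ∀ c, N ≤ (K c).card) (k : ℕ)
    (hk : 3 * D.card + 5 * k ≤ N) :
    ∃ σ : List (Step C X), σ.length = k ∧ IsPath A D p c₀ σ ∧ σ.Pairwise Indep ∧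
      ∀ j < k, ∃ (B : Finset C) (e : C → Step C X), B ⊆ D ∧
        N ≤ 2 * B.card + 1 + 3 * D.card + 5 * j ∧
        (∀ b ∈ B, (e b).dst = b ∧ IsPath A D p c₀ (σ.take j ++ [e b]) ∧
          (σ.take j ++ [e b]).Pairwise Indep ∧ ¬ Reach A D p c₀ (σ.take (j + 1)) (e b)) ∧
        ∀ b ∈ B, ∀ b' ∈ B, ∀ s t, (e b).lab s = (e b').lab t → b = b' := by
  induction k with
  | zero => exact ⟨[], rfl, trivial, List.Pairwise.nil, by simp⟩
  | succ k ih =>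
    obtain ⟨σ, hlen, hσ, hi, hB⟩ := ih (by omega)
    have hNK := hN (endpt c₀ σ)
    obtain ⟨a, B, e, ha, hai, hBD, hBc, he, hinj⟩ :=
      hp.exists_extension hc₀ hmax hσ hi (hK _) (by omega)
    refine ⟨σ ++ [a], by simp [hlen], ha, hai, fun j hj => ?_⟩
    rcases Nat.lt_succ_iff_lt_or_eq.1 hj with hj | rfl
    · rw [List.take_append_of_le_length (by omega), List.take_append_of_le_length (by omega)]
      exact hB j hj
    · have h₁ : (σ ++ [a]).take j = σ := by simp [← hlen]
      have h₂ : (σ ++ [a]).take (j + 1) = σ ++ [a] := List.take_of_length_le (by simp [hlen])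
      rw [h₁, h₂]
      exact ⟨B, e, hBD, by omega, he, hinj⟩

/-- An upper bound for the size of the kernels if no larger matching exists. -/
theorem IsRainbow.mul_le_of_maximal [DecidableEq C] (hp : IsRainbow A D p) {c₀ : C}
    (hc₀ : c₀ ∉ D) (hmax : ¬ ∃ q, IsRainbow A (insert c₀ D) q) {K : C → Finset X} {N : ℕ}
    (hK : ∀ c, ∀ x ∈ K c, ∃ z, z ≠ x ∧ (A c).r x z) (hN : ∀ c, N ≤ (K c).card) (k : ℕ)
    (hk : 3 * D.card + 5 * k ≤ N) :
    k * N ≤ 4 * D.card + k * (3 * D.card + 5 * k) := by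
  classical
  obtain ⟨σ, hlen, hσ, hi, h⟩ := hp.exists_long_path hc₀ hmax hK hN k hk
  rcases Nat.eq_zero_or_pos k with rfl | hk₀
  · simp
  have : Nonempty (C → Step C X) := let ⟨_, e, _⟩ := h 0 hk₀; ⟨e⟩
  choose! B e hBD hBc he hinj using h
  let good : ℕ → C → Prop := fun j b =>
    b ∈ B j ∧ ∀ i ∈ σ.drop j, ∀ s t, i.lab s ≠ (e j b).lab t
  have hgood : ∀ j ∈ Finset.range k,
      N ≤ 2 * (D.filter (good j)).card + (3 * D.card + 5 * k) := by
    intro j hj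
    rw [Finset.mem_range] at hj
    have h₁ : (B j \ D.filter (good j)).card ≤ (labels (σ.drop j)).card := by
      have hex : ∀ b ∈ B j \ D.filter (good j),
          ∃ x, x ∈ labels (σ.drop j) ∧ ∃ t, (e j b).lab t = x := by
        intro b hb
        rw [Finset.mem_sdiff] at hb
        have : ¬ good j b := fun h => hb.2 (Finset.mem_filter.2 ⟨hBD j hj hb.1, h⟩)
        simp only [good, hb.1, true_and] at this
        push Not at this
        obtain ⟨i, hi, s, t, hst⟩ := this
        exact ⟨_, mem_labels.2 ⟨i, hi, s, rfl⟩, t, hst.symm⟩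
      have : Nonempty X := let ⟨e⟩ := ‹Nonempty (C → Step C X)›; ⟨(e c₀).lab true⟩
      choose! f hf hf' using hex
      refine Finset.card_le_card_of_injOn f hf fun b hb b' hb' hbb => ?_
      obtain ⟨t, ht⟩ := hf' b hb
      obtain ⟨t', ht'⟩ := hf' b' hb'
      exact hinj j hj b (Finset.mem_sdiff.1 hb).1 b' (Finset.mem_sdiff.1 hb').1 t t'
        (by rw [ht, ht', hbb])
    have h₂ := card_labels_le (σ.drop j)
    have h₃ := Finset.card_le_card_sdiff_add_card (s := B j) (t := D.filter (good j))
    have h₄ := hBc j hj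
    rw [List.length_drop, hlen] at h₂
    omega
  have hcross : ∀ j₁ j₂ b, j₁ < j₂ → j₂ < k → good j₁ b → good j₂ b →
      ∀ t, (e j₂ b).lab t = (e j₁ b).lab (!t) := by
    intro j₁ j₂ b h₁₂ h₂ hb₁ hb₂
    by_contra hcr
    obtain ⟨hd₁, -, -, hR⟩ := he j₁ (by omega) b hb₁.1
    obtain ⟨hd₂, hpath, hpw, -⟩ := he j₂ h₂ b hb₂.1
    have htake : σ.take (j₁ + 1) ++ (σ.take j₂).drop (j₁ + 1) = σ.take j₂ := by
      have := List.take_append_drop (j₁ + 1) (σ.take j₂)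
      rwa [List.take_take, Nat.min_eq_left (by omega)] at this
    refine hR ⟨(σ.take j₂).drop (j₁ + 1), e j₂ b, by rwa [htake], by rwa [htake],
      hd₂.trans hd₁.symm, fun i hi => hb₁.2 i ?_, hcr⟩
    rw [List.drop_take] at hi
    exact (List.drop_sublist_drop_left σ (Nat.le_succ j₁)).subset (List.mem_of_mem_take hi)
  have hcross' : ∀ i ∈ Finset.range k, ∀ j ∈ Finset.range k, ∀ b, i ≠ j → good i b → good j b →
      ∀ t, (e i b).lab t = (e j b).lab (!t) := by
    intro i hi j hj b hij hb hb' t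
    rcases lt_or_gt_of_ne hij with h | h
    · simpa using (hcross i j b h (Finset.mem_range.1 hj) hb hb' (!t)).symm
    · exact hcross j i b h (Finset.mem_range.1 hi) hb' hb t
  have htwo : ∀ b ∈ D, ((Finset.range k).filter fun j => good j b).card ≤ 2 := by
    intro b _
    by_contra! hlt
    obtain ⟨i, j, l, hi, hj, hl, hij, hil, hjl⟩ := Finset.two_lt_card_iff.1 hlt
    rw [Finset.mem_filter] at hi hj hl
    have h₁ := hcross' i hi.1 j hj.1 b hij hi.2 hj.2 true
    have h₂ := hcross' j hj.1 l hl.1 b hjl hj.2 hl.2 false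
    have h₃ := hcross' i hi.1 l hl.1 b hil hi.2 hl.2 false
    have hs : IsStep A D p (e i b) :=
      (he i (Finset.mem_range.1 hi.1) b hi.2.1).2.1.isStep _ (by simp)
    refine hs.lab_ne ?_
    rw [h₃, ← h₂, h₁]
    rfl
  have hsum := Finset.sum_le_sum hgood
  have hsum' : ∑ j ∈ Finset.range k, (D.filter (good j)).card ≤ D.card * 2 :=
    (Finset.sum_card_bipartiteAbove_eq_sum_card_bipartiteBelow good).trans_le
      (Finset.sum_le_card_nsmul D _ 2 htwo)
  simp only [Finset.sum_add_distrib, ← Finset.mul_sum, Finset.sum_const, Finset.card_range,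
    smul_eq_mul] at hsum
  linarith

end

theorem exists_nat_mul_mem {δ n : ℝ} (hδ : 0 < δ) (hn : 144 / δ ^ 2 ≤ n) (hn₁ : 1 ≤ n) :
    ∃ k : ℕ, 5 * (k : ℝ) ≤ δ * n ∧ 4 * n + 5 * (k : ℝ) ^ 2 < k * (δ * n) := by
  rw [div_le_iff₀ (by positivity)] at hn
  rcases le_total δ 16 with h | h
  · refine ⟨⌈8 / δ⌉₊, ?_⟩
    have h₁ := Nat.le_ceil (8 / δ)
    have h₂ := Nat.ceil_lt_add_one (a := 8 / δ) (by positivity)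
    generalize (⌈8 / δ⌉₊ : ℝ) = k at h₁ h₂
    rw [div_le_iff₀ hδ] at h₁
    have h₃ : k * δ < 24 := by
      have := mul_lt_mul_of_pos_right h₂ hδ
      rw [add_mul, div_mul_cancel₀ _ hδ.ne'] at this
      linarith
    constructor
    · refine le_of_mul_le_mul_right ?_ hδ
      nlinarith
    · refine lt_of_mul_lt_mul_right ?_ (sq_nonneg δ)
      have h₄ : (k * δ - 4) * 144 ≤ (k * δ - 4) * (n * δ ^ 2) :=
        mul_le_mul_of_nonneg_left hn (by linarith)
      have h₅ : 0 < (k * δ - 24 / 5) * (24 - k * δ) := mul_pos (by linarith) (by linarith)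
      linear_combination h₄ + 5 * h₅
  · refine ⟨1, ?_, ?_⟩ <;> push_cast <;> nlinarith

/-- If the kernels are large compared to the number of colours, there is a rainbow matching. -/
theorem exists_isRainbow_univ {C X : Type*} [Fintype C] (A : C → Setoid X) (x₀ : X) {δ : ℝ}
    (hδ : 0 < δ) (hn : 144 / δ ^ 2 ≤ (Fintype.card C : ℝ)) (K : C → Finset X)
    (hK : ∀ c, ∀ x ∈ K c, ∃ z, z ≠ x ∧ (A c).r x z)
    (hcard : ∀ c, (3 + δ) * Fintype.card C ≤ ((K c).card : ℝ)) :
    ∃ p, IsRainbow A Finset.univ p := by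
  classical
  obtain ⟨D, hD, hmax⟩ := (Finset.univ.filter fun D : Finset C =>
    ∃ p, IsRainbow A D p).exists_max_image Finset.card
      ⟨∅, by simpa using ⟨fun _ _ => x₀, by simp, by simp⟩⟩
  obtain ⟨p, hp⟩ := (Finset.mem_filter.1 hD).2
  by_cases huniv : D = Finset.univ
  · exact ⟨p, huniv ▸ hp⟩
  obtain ⟨c₀, hc₀⟩ : ∃ c₀, c₀ ∉ D := by
    simpa [Finset.eq_univ_iff_forall] using huniv
  have hno : ¬ ∃ q, IsRainbow A (insert c₀ D) q := fun h => by
    have := hmax _ (Finset.mem_filter.2 ⟨Finset.mem_univ _, h⟩)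
    rw [Finset.card_insert_of_notMem hc₀] at this
    omega
  have hone : (1 : ℝ) ≤ Fintype.card C := by
    exact_mod_cast Fintype.card_pos_iff.2 ⟨c₀⟩
  obtain ⟨k, hk₁, hk₂⟩ := exists_nat_mul_mem hδ hn hone
  have hDC : (D.card : ℝ) ≤ Fintype.card C := by exact_mod_cast D.card_le_univ
  have hN := Nat.le_ceil ((3 + δ) * (Fintype.card C : ℝ))
  have h := hp.mul_le_of_maximal hc₀ hno hK (fun c => Nat.ceil_le.2 (hcard c)) k (by
    have : (3 * D.card + 5 * k : ℝ) ≤ ⌈(3 + δ) * (Fintype.card C : ℝ)⌉₊ := by linarith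
    exact_mod_cast this)
  have h' : (k * ⌈(3 + δ) * (Fintype.card C : ℝ)⌉₊ : ℝ) ≤
      4 * D.card + k * (3 * D.card + 5 * k) := by exact_mod_cast h
  have h₁ := mul_le_mul_of_nonneg_left hN k.cast_nonneg
  have h₂ := mul_le_mul_of_nonneg_left hDC (k.cast_nonneg (α := ℝ))
  nlinarith

end RainbowMatching

/-- Main theorem: for every `δ > 0` and every `n ≥ 144/δ²`, if `A_1, …, A_n` are equivalence
relations on a finite set `X` with `|ker(A_i)| ≥ (3 + δ)n` for each `i`, then there exist
`2n` distinct elements `x_1, y_1, …, x_n, y_n ∈ X` with `x_i ∼_{A_i} y_i` for each `i`. -/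
theorem stmt_17 (δ : ℝ) (hδ : 0 < δ) (n : ℕ) (hn : 144 / δ ^ 2 ≤ (n : ℝ))
    {X : Type*} [Fintype X] (A : Fin n → Setoid X)
    (hker : ∀ i : Fin n,
      (3 + δ) * n ≤ ({x : X | 2 ≤ {z : X | (A i).r x z}.ncard}.ncard : ℝ)) :
    ∃ x y : Fin n → X,
      (∀ i : Fin n, (A i).r (x i) (y i)) ∧
      Function.Injective (fun p : Fin n × Bool => if p.2 then x p.1 else y p.1) := by
  classical
  rcases Nat.eq_zero_or_pos n with rfl | hpos
  · exact ⟨Fin.elim0, Fin.elim0, fun i => i.elim0, fun p => p.1.elim0⟩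
  have hmem : ∀ i, ∀ x ∈ {x : X | 2 ≤ {z : X | (A i).r x z}.ncard},
      ∃ z, z ≠ x ∧ (A i).r x z := by
    intro i x hx
    obtain ⟨z, hz, hzx⟩ := Set.exists_ne_of_one_lt_ncard hx x
    exact ⟨z, hzx, hz⟩
  obtain ⟨x₀⟩ : Nonempty X := by
    by_contra hX
    rw [not_nonempty_iff] at hX
    have h := hker ⟨0, hpos⟩
    rw [Set.eq_empty_of_isEmpty {x : X | _}, Set.ncard_empty, Nat.cast_zero] at h
    have : (0 : ℝ) < n := by exact_mod_cast hpos
    exact h.not_gt (by positivity)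
  obtain ⟨p, hp⟩ := RainbowMatching.exists_isRainbow_univ A x₀ hδ (by simpa using hn)
    (fun i => {x : X | 2 ≤ {z : X | (A i).r x z}.ncard}.toFinset)
    (fun i x hx => hmem i x (Set.mem_toFinset.1 hx)) (fun i => by
      rw [← Set.ncard_eq_toFinset_card', Fintype.card_fin]
      exact hker i)
  refine ⟨fun i => p i true, fun i => p i false, fun i => hp.rel i (Finset.mem_univ i), ?_⟩
  have hif : ∀ q : Fin n × Bool, (if q.2 then p q.1 true else p q.1 false) = p q.1 q.2 := by
    rintro ⟨i, _ | _⟩ <;> rfl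
  intro q r hqr
  simp only [hif] at hqr
  obtain ⟨h₁, h₂⟩ := hp.inj q.1 (Finset.mem_univ _) r.1 (Finset.mem_univ _) q.2 r.2 hqr
  exact Prod.ext h₁ h₂
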